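/- There exists a constant C > 0 such that for every continuously differentiable function v : ℝ² → ℝ that vanishes on the side {(x, 0) : 0 ≤ x ≤ 1} of the unit triangle T = {(x, y) ∈ ℝ² : x ≥ 0, y ≥ 0, x + y ≤ 1}, one has (∫₀¹ v(0, y)² dy)^{1/2} ≤ C · (∫_T v²)^{1/4} · (∫_T ‖∇v‖²)^{1/4}. -/

import Mathlib

open MeasureTheory

/-- The closed triangle with vertices `(0, 0)`, `(1, 0)` and `(0, 1)`. -/
def unitTriangle : Set (ℝ × ℝ) := {p | 0 ≤ p.1 ∧ 0 ≤ p.2 ∧ p.1 + p.2 ≤ 1}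

theorem isCompact_unitTriangle : IsCompact unitTriangle := by
  have hc : IsClosed unitTriangle := by
    refine (isClosed_le continuous_const continuous_fst).inter
      ((isClosed_le continuous_const continuous_snd).inter
        (isClosed_le (continuous_fst.add continuous_snd) continuous_const))
  refine (isCompact_Icc (a := ((0, 0) : ℝ × ℝ)) (b := (1, 1))).of_isClosed_subset hc ?_
  rintro ⟨x, y⟩ ⟨hx, hy, hxy⟩
  dsimp only at hx hy hxy
  exact ⟨⟨hx, hy⟩, ⟨by dsimp only; linarith, by dsimp only; linarith⟩⟩

/-- Moving from `(0, y)` to `(y, 0)` along the segment of slope `-1`. -/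
theorem sq_le_integral_antidiagonal {v : ℝ × ℝ → ℝ} (hv : ContDiff ℝ 1 v) {y : ℝ}
    (hy : 0 ≤ y) (h0 : v (y, 0) = 0) :
    v (0, y) ^ 2 ≤ ∫ t in (0 : ℝ)..y, 2 * (|v (t, y - t)| * ‖fderiv ℝ v (t, y - t)‖) := by
  have hvc := hv.continuous
  have hdc := hv.continuous_fderiv one_ne_zero
  have hderiv (t : ℝ) : HasDerivAt (fun t => v (t, y - t) ^ 2)
      (2 * v (t, y - t) * fderiv ℝ v (t, y - t) (1, -1)) t := by
    have h1 : HasDerivAt (fun t : ℝ => (t, y - t)) ((1, -1) : ℝ × ℝ) t :=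
      (hasDerivAt_id t).prodMk ((hasDerivAt_id t).const_sub y)
    have h2 := ((hv.differentiable one_ne_zero (t, y - t)).hasFDerivAt.comp_hasDerivAt t h1).pow 2
    simpa [Pi.pow_def, Function.comp_def] using h2
  have hcont : Continuous fun t : ℝ => 2 * v (t, y - t) * fderiv ℝ v (t, y - t) (1, -1) := by
    fun_prop
  have hftc := intervalIntegral.integral_eq_sub_of_hasDerivAt (fun t _ => hderiv t)
    (hcont.intervalIntegrable 0 y)
  simp only [sub_self, h0, sub_zero] at hftc
  calc v (0, y) ^ 2
      = ∫ t in (0 : ℝ)..y, -(2 * v (t, y - t) * fderiv ℝ v (t, y - t) (1, -1)) := by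
        rw [intervalIntegral.integral_neg, hftc]; ring
    _ ≤ _ := by
        refine intervalIntegral.integral_mono_on hy (hcont.neg.intervalIntegrable 0 y)
          (Continuous.intervalIntegrable (by fun_prop) 0 y) fun t _ => ?_
        have hnorm : |fderiv ℝ v (t, y - t) (1, -1)| ≤ ‖fderiv ℝ v (t, y - t)‖ := by
          simpa [Prod.norm_def] using (fderiv ℝ v (t, y - t)).le_opNorm (1, -1)
        refine (neg_le_abs _).trans ?_
        rw [abs_mul, abs_mul, abs_two, mul_assoc]
        gcongr

/-- Fubini's theorem along the segments of slope `-1`, as an inequality. -/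
theorem integral_le_setIntegral_unitTriangle {g : ℝ × ℝ → ℝ} (hg : Continuous g)
    (hg0 : ∀ p, 0 ≤ g p) {w : ℝ → ℝ} (hw : Continuous w)
    (hwg : ∀ y, 0 ≤ y → y ≤ 1 → w y ≤ ∫ t in (0 : ℝ)..y, g (t, y - t)) :
    ∫ y in (0 : ℝ)..1, w y ≤ ∫ p in unitTriangle, g p := by
  have hT := isCompact_unitTriangle.measurableSet
  set f := unitTriangle.indicator g
  have hf0 : 0 ≤ f := Set.indicator_nonneg fun p _ => hg0 p
  have hfint : Integrable f :=
    (hg.continuousOn.integrableOn_compact isCompact_unitTriangle).integrable_indicator hT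
  set F : ℝ × ℝ → ℝ := fun p => f (p.1, p.2 - p.1)
  have he : MeasurePreserving (MeasurableEquiv.shearAddRight ℝ)
      (volume : Measure (ℝ × ℝ)) volume := measurePreserving_prod_add volume volume
  have hFe : F ∘ MeasurableEquiv.shearAddRight ℝ = f := by
    ext p
    simp [F, MeasurableEquiv.shearAddRight]
  have hFint : Integrable F :=
    (he.integrable_comp_emb (MeasurableEquiv.shearAddRight ℝ).measurableEmbedding).1
      (hFe.symm ▸ hfint)
  have hslice (y : ℝ) (hy0 : 0 ≤ y) (hy1 : y ≤ 1) :
      ∫ t, F (t, y) = ∫ t in (0 : ℝ)..y, g (t, y - t) := by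
    rw [intervalIntegral.integral_of_le hy0, ← integral_Icc_eq_integral_Ioc,
      ← integral_indicator measurableSet_Icc]
    congr 1 with t
    simp only [F, f, Set.indicator, unitTriangle, Set.mem_ofPred_eq, Set.mem_Icc, sub_nonneg,
      add_sub_cancel, hy1, and_true]
  calc ∫ y in (0 : ℝ)..1, w y
      ≤ ∫ y in Set.Ioc (0 : ℝ) 1, ∫ t, F (t, y) := by
        rw [intervalIntegral.integral_of_le zero_le_one]
        refine setIntegral_mono_on (hw.integrableOn_Ioc) hFint.integral_prod_right.integrableOn
          measurableSet_Ioc fun y hy => ?_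
        rw [hslice y hy.1.le hy.2]
        exact hwg y hy.1.le hy.2
    _ ≤ ∫ y, ∫ t, F (t, y) :=
        setIntegral_le_integral hFint.integral_prod_right
          (Filter.Eventually.of_forall fun y => integral_nonneg fun t => hf0 _)
    _ = ∫ p, F p := (integral_prod_symm F hFint).symm
    _ = ∫ p, f p := by
        rw [← he.integral_comp', ← hFe]
        rfl
    _ = ∫ p in unitTriangle, g p := integral_indicator hT

/-- The Cauchy–Schwarz inequality for nonnegative continuous functions on a compact set. -/
theorem IsCompact.setIntegral_mul_le_sqrt_mul_sqrt {K : Set (ℝ × ℝ)} (hK : IsCompact K)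
    {a b : ℝ × ℝ → ℝ} (ha : Continuous a) (hb : Continuous b)
    (ha0 : ∀ p, 0 ≤ a p) (hb0 : ∀ p, 0 ≤ b p) :
    ∫ p in K, a p * b p ≤
      (∫ p in K, a p ^ 2) ^ ((1 : ℝ) / 2) * (∫ p in K, b p ^ 2) ^ ((1 : ℝ) / 2) := by
  have hmem {c : ℝ × ℝ → ℝ} (hc : Continuous c) :
      MemLp c (ENNReal.ofReal 2) (volume.restrict K) := by
    rw [ENNReal.ofReal_ofNat, memLp_two_iff_integrable_sq hc.aestronglyMeasurable]
    exact (hc.pow 2).continuousOn.integrableOn_compact hK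
  simpa using integral_mul_le_Lp_mul_Lq_of_nonneg (Real.HolderConjugate.two_two)
    (Filter.Eventually.of_forall ha0) (Filter.Eventually.of_forall hb0) (hmem ha) (hmem hb)

/-- Trace-type estimate on the reference triangle: there is a constant `C > 0` such that
for every `C¹` function `v` on `ℝ²` vanishing on the bottom side of the unit triangle
`T = {(x,y) : x ≥ 0, y ≥ 0, x + y ≤ 1}`, the `L²` norm of `v` on the left side is bounded
by `C` times the square root of the product of `‖v‖_{L²(T)}` and `‖∇v‖_{L²(T)}`. -/
theorem trace_estimate_reference_triangle :
    ∃ C > (0 : ℝ), ∀ v : ℝ × ℝ → ℝ, ContDiff ℝ 1 v →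
      (∀ x : ℝ, 0 ≤ x → x ≤ 1 → v (x, 0) = 0) →
      (∫ y in (0:ℝ)..1, (v (0, y)) ^ 2) ^ ((1 : ℝ) / 2) ≤
        C * (∫ p in {p : ℝ × ℝ | 0 ≤ p.1 ∧ 0 ≤ p.2 ∧ p.1 + p.2 ≤ 1}, (v p) ^ 2) ^ ((1 : ℝ) / 4)
          * (∫ p in {p : ℝ × ℝ | 0 ≤ p.1 ∧ 0 ≤ p.2 ∧ p.1 + p.2 ≤ 1},
              ‖fderiv ℝ v p‖ ^ 2) ^ ((1 : ℝ) / 4) := by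
  refine ⟨2 ^ ((1 : ℝ) / 2), by positivity, fun v hv h0 => ?_⟩
  have hvc := hv.continuous
  have hdc := hv.continuous_fderiv one_ne_zero
  change _ ≤ 2 ^ ((1 : ℝ) / 2) * (∫ p in unitTriangle, v p ^ 2) ^ ((1 : ℝ) / 4) *
    (∫ p in unitTriangle, ‖fderiv ℝ v p‖ ^ 2) ^ ((1 : ℝ) / 4)
  have hA : 0 ≤ ∫ p in unitTriangle, v p ^ 2 := integral_nonneg fun p => sq_nonneg _
  have hB : 0 ≤ ∫ p in unitTriangle, ‖fderiv ℝ v p‖ ^ 2 := integral_nonneg fun p => sq_nonneg _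
  have hfubini := integral_le_setIntegral_unitTriangle
    (g := fun p => 2 * (|v p| * ‖fderiv ℝ v p‖)) (by fun_prop) (fun p => by positivity)
    (w := fun y => v (0, y) ^ 2) (by fun_prop)
    fun y hy0 hy1 => sq_le_integral_antidiagonal hv hy0 (h0 y hy0 hy1)
  have hcs := isCompact_unitTriangle.setIntegral_mul_le_sqrt_mul_sqrt hvc.abs hdc.norm
    (fun p => abs_nonneg _) (fun p => norm_nonneg _)
  simp only [sq_abs] at hcs
  rw [integral_const_mul] at hfubini
  have hquarter {x : ℝ} (hx : 0 ≤ x) :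
      (x ^ ((1 : ℝ) / 2)) ^ ((1 : ℝ) / 2) = x ^ ((1 : ℝ) / 4) := by
    rw [← Real.rpow_mul hx]
    norm_num
  rw [← hquarter hA, ← hquarter hB, ← Real.mul_rpow (by positivity) (by positivity),
    ← Real.mul_rpow (by positivity) (by positivity)]
  refine Real.rpow_le_rpow
    (intervalIntegral.integral_nonneg zero_le_one fun y _ => sq_nonneg _) ?_ (by norm_num)
  linarith
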